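/- arXiv:2107.08901 — 3 statements merged into one kernel-verified Lean document; each statement's English description precedes it below -/
import Mathlib

section
/- Let X be a topological space. (i) For any two decreasing sequences (U_n)_{n∈ℕ} and (W_n)_{n∈ℕ} of subsets of X (U_{n+1} ⊆ U_n, W_{n+1} ⊆ W_n), the pointwise inequality ∑_{n=0}^∞ 1_{U_n}(t) ≤ ∑_{n=0}^∞ 1_{W_n}(t) in ℕ̄ for all t ∈ X holds if and only if U_n ⊆ W_n for every n. (ii) Every lower semicontinuous function f : X → ℕ̄ satisfies f = ∑_{n=0}^∞ 1_{V_n} pointwise, where V_n := f⁻¹(]n,∞]) is a decreasing sequence of open subsets of X. Consequently the indicator functions of open subsets of X form a set Λ := Lsc(X,{0,1}) satisfying the two defining conditions of a chain-generating set of Lsc(X,ℕ̄). -/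
open Set

theorem icg_key {X : Type*} (U : ℕ → Set X) (hU : ∀ n, U (n + 1) ⊆ U n) (t : X) (n : ℕ) :
    ((n : ℕ∞) < ⨆ k : ℕ, ∑ m ∈ Finset.range k, (U m).indicator (fun _ => (1 : ℕ∞)) t) ↔
      t ∈ U n := by
  have anti : Antitone U := antitone_nat_of_succ_le hU
  constructor
  · intro h
    by_contra hn
    refine absurd h (not_lt.mpr (iSup_le fun k => ?_))
    have hz : ∀ m, n ≤ m → (U m).indicator (fun _ => (1 : ℕ∞)) t = 0 := fun m hm =>
      Set.indicator_of_notMem (fun h' => hn (anti hm h')) _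
    calc ∑ m ∈ Finset.range k, (U m).indicator (fun _ => (1 : ℕ∞)) t
        ≤ ∑ m ∈ Finset.range (max n k), (U m).indicator (fun _ => (1 : ℕ∞)) t :=
          Finset.sum_le_sum_of_subset (Finset.range_mono (le_max_right _ _))
      _ = ∑ m ∈ Finset.range n, (U m).indicator (fun _ => (1 : ℕ∞)) t := by
          symm
          apply Finset.sum_subset (Finset.range_mono (le_max_left _ _))
          intro m _ hm
          exact hz m (by simpa using hm)
      _ ≤ ∑ m ∈ Finset.range n, (1 : ℕ∞) :=
          Finset.sum_le_sum fun m _ => Set.indicator_le_self' (fun _ _ => zero_le) t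
      _ = n := by simp
  · intro h
    refine lt_of_lt_of_le ?_ (le_iSup _ (n + 1))
    have : ∑ m ∈ Finset.range (n + 1), (U m).indicator (fun _ => (1 : ℕ∞)) t
        = ((n + 1 : ℕ) : ℕ∞) := by
      rw [Finset.sum_congr rfl (g := fun _ => (1 : ℕ∞))]
      · simp
      · intro m hm
        exact Set.indicator_of_mem (anti (by simpa [Nat.lt_succ_iff] using hm) h) _
    rw [this]
    exact_mod_cast Nat.lt_succ_self n

theorem icg_le {a b : ℕ∞} (h : ∀ n : ℕ, (n : ℕ∞) < a → (n : ℕ∞) < b) : a ≤ b := by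
  by_contra hc
  rw [not_le] at hc
  obtain ⟨m, rfl⟩ := ENat.ne_top_iff_exists.mp hc.ne_top
  exact lt_irrefl _ (h m hc)

/-- Indicator-sum comparison for decreasing chains of sets, and the canonical
chain-decomposition of a lower semicontinuous `ℕ̄`-valued function: the open indicators
form a chain-generating set of `Lsc(X, ℕ̄)`. -/
theorem indicator_chain_generating (X : Type*) [TopologicalSpace X] :
    -- (i) comparison of sums of indicators of decreasing chains of subsets
    (∀ U W : ℕ → Set X, (∀ n, U (n + 1) ⊆ U n) → (∀ n, W (n + 1) ⊆ W n) →
      ((∀ t : X, (⨆ k : ℕ, ∑ n ∈ Finset.range k, (U n).indicator (fun _ => (1 : ℕ∞)) t) ≤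
          ⨆ k : ℕ, ∑ n ∈ Finset.range k, (W n).indicator (fun _ => (1 : ℕ∞)) t) ↔
        ∀ n, U n ⊆ W n)) ∧
    -- (ii) every lsc function is the sum of the indicators of its level sets
    (∀ f : X → ℕ∞, (∀ n : ℕ, IsOpen {t | (n : ℕ∞) < f t}) →
      (∀ n : ℕ, {t | ((n + 1 : ℕ) : ℕ∞) < f t} ⊆ {t | (n : ℕ∞) < f t}) ∧
      (∀ n : ℕ, IsOpen {t | (n : ℕ∞) < f t}) ∧
      (∀ t : X, f t = ⨆ k : ℕ, ∑ n ∈ Finset.range k,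
        ({s | (n : ℕ∞) < f s}).indicator (fun _ => (1 : ℕ∞)) t)) := by
  refine ⟨fun U W hU hW => ⟨fun h n t ht => ?_, fun h t => ?_⟩, fun f hf => ?_⟩
  · exact (icg_key W hW t n).1 (((icg_key U hU t n).2 ht).trans_le (h t))
  · exact icg_le fun n hn => (icg_key W hW t n).2 (h n ((icg_key U hU t n).1 hn))
  · have hd : ∀ n : ℕ, {t | ((n + 1 : ℕ) : ℕ∞) < f t} ⊆ {t | (n : ℕ∞) < f t} := fun n t ht =>
      lt_trans (Nat.cast_lt.mpr (Nat.lt_succ_self n) : (n : ℕ∞) < ((n + 1 : ℕ) : ℕ∞)) ht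
    refine ⟨hd, hf, fun t => ?_⟩
    have key := icg_key (fun n : ℕ => {s | (n : ℕ∞) < f s}) hd t
    exact le_antisymm (icg_le fun n hn => (key n).2 hn) (icg_le fun n hn => (key n).1 hn)
end

section
/- In the partially ordered monoid Lsc(]0,1[,ℕ̄) of lower semicontinuous functions ]0,1[ → ℕ̄, let n ∈ ℕ, n ≥ 1, and let M_n be the set of finite-valued lower semicontinuous functions that are constant on each dyadic open interval U_k = ]((k−1)/2^n, k/2^n[, 1 ≤ k ≤ 2^n. If g', g ∈ M_n satisfy g' ≪ g, then there exists h ∈ M_{n+1} with g' ≪ h ≪ g. -/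
open Set

/-- The open unit interval `]0,1[` as a topological space. -/
abbrev Io01 : Type := ↥(Set.Ioo (0 : ℝ) 1)

/-- Lower semicontinuity for `ℕ̄`-valued functions. -/
def IsLscFn {X : Type*} [TopologicalSpace X] (f : X → ℕ∞) : Prop :=
  ∀ m : ℕ, IsOpen {t | (m : ℕ∞) < f t}

/-- The way-below relation on `Lsc(]0,1[, ℕ̄)`, phrased inside the ambient function space:
`f ≪ g` iff every increasing sequence of lsc functions whose pointwise supremum dominates `g`
eventually dominates `f`. -/
def WayBelowLsc (f g : Io01 → ℕ∞) : Prop :=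
  ∀ h : ℕ → (Io01 → ℕ∞), (∀ m, IsLscFn (h m)) → Monotone h →
    (∀ t, g t ≤ ⨆ m, h m t) → ∃ m, f ≤ h m

/-- `M_n`: finite-valued lsc functions constant on each open dyadic interval of size `1/2^n`. -/
def Mdyadic (n : ℕ) : Set (Io01 → ℕ∞) :=
  {f | IsLscFn f ∧ (∀ t, f t ≠ ⊤) ∧
    ∀ k : ℕ, 1 ≤ k → k ≤ 2 ^ n → ∀ s t : Io01,
      (s : ℝ) ∈ Set.Ioo (((k : ℝ) - 1) / 2 ^ n) ((k : ℝ) / 2 ^ n) →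
      (t : ℝ) ∈ Set.Ioo (((k : ℝ) - 1) / 2 ^ n) ((k : ℝ) / 2 ^ n) → f s = f t}

/-- Superlevel set as a subset of the reals. -/
def SL (f : Io01 → ℕ∞) (m : ℕ) : Set ℝ := {y | ∃ hy : y ∈ Set.Ioo (0:ℝ) 1, (m : ℕ∞) < f ⟨y, hy⟩}

theorem SL_val (f : Io01 → ℕ∞) (m : ℕ) (t : Io01) : (t : ℝ) ∈ SL f m ↔ (m : ℕ∞) < f t :=
  ⟨fun ⟨_, h⟩ => h, fun h => ⟨t.2, h⟩⟩

theorem SL_open {f : Io01 → ℕ∞} (hf : IsLscFn f) (m : ℕ) : IsOpen (SL f m) := by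
  have h1 := isOpen_Ioo.isOpenMap_subtype_val (X := ℝ) (s := Set.Ioo (0:ℝ) 1) _ (hf m)
  have : SL f m = Subtype.val '' {t : Io01 | (m : ℕ∞) < f t} := by
    ext y
    constructor
    · rintro ⟨hy, h⟩
      exact ⟨⟨y, hy⟩, h, rfl⟩
    · rintro ⟨t, h, rfl⟩
      exact ⟨t.2, h⟩
  rw [this]
  exact h1

theorem wb_bdd {f g : Io01 → ℕ∞} (hg : IsLscFn g) (h : WayBelowLsc f g) :
    ∃ N : ℕ, ∀ t, f t ≤ N := by
  obtain ⟨N, hN⟩ := h (fun m t => min (g t) (m : ℕ∞)) (by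
    intro m l
    by_cases hl : l < m
    · have : {t | (l : ℕ∞) < min (g t) (m : ℕ∞)} = {t | (l : ℕ∞) < g t} := by
        ext t
        simp [hl]
      rw [this]
      exact hg l
    · have : {t | (l : ℕ∞) < min (g t) (m : ℕ∞)} = ∅ := by
        ext t
        simp [hl]
      rw [this]
      exact isOpen_empty) (by
    intro a b hab t
    exact min_le_min le_rfl (Nat.mono_cast hab)) (by
    intro t
    by_cases ht : g t = ⊤
    · simp only [ht, min_eq_right le_top]
      exact (ENat.iSup_natCast).ge
    · obtain ⟨k, hk⟩ := ENat.ne_top_iff_exists.1 ht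
      refine le_trans ?_ (le_iSup _ k)
      simp [← hk])
  exact ⟨N, fun t => (hN t).trans (min_le_right _ _)⟩

theorem wb_eps {f g : Io01 → ℕ∞} (hg : IsLscFn g) (h : WayBelowLsc f g) (m : ℕ) :
    ∃ ε > 0, ∀ s ∈ SL f m, ∀ y : ℝ, |y - s| < ε → y ∈ SL g m := by
  classical
  have hO := SL_open hg m
  have hne : ((SL g m)ᶜ).Nonempty := ⟨0, fun ⟨hy, _⟩ => lt_irrefl _ hy.1⟩
  let V : ℕ → Set Io01 := fun j => {t | 1 / ((j : ℝ) + 1) < Metric.infDist (t : ℝ) (SL g m)ᶜ}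
  have hV : ∀ j, IsOpen (V j) := fun j =>
    isOpen_lt continuous_const ((Metric.continuous_infDist_pt _).comp continuous_subtype_val)
  obtain ⟨j, hj⟩ := h (fun j t => if t ∈ V j then g t else min (g t) (m : ℕ∞)) (by
    intro j l
    by_cases hl : l < m
    · have : {t | (l : ℕ∞) < if t ∈ V j then g t else min (g t) (m : ℕ∞)}
          = {t | (l : ℕ∞) < g t} := by
        ext t
        by_cases ht : t ∈ V j <;> simp [hl, ht]
      rw [this]
      exact hg l
    · have : {t | (l : ℕ∞) < if t ∈ V j then g t else min (g t) (m : ℕ∞)}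
          = V j ∩ {t | (l : ℕ∞) < g t} := by
        ext t
        by_cases ht : t ∈ V j <;> simp [hl, ht]
      rw [this]
      exact (hV j).inter (hg l)) (by
    intro a b hab t
    have hVm : t ∈ V a → t ∈ V b := by
      intro ht
      have h1 : (a : ℝ) ≤ b := Nat.cast_le.2 hab
      have h2 : 1 / ((b : ℝ) + 1) ≤ 1 / ((a : ℝ) + 1) :=
        one_div_le_one_div_of_le (by positivity) (by linarith)
      exact lt_of_le_of_lt h2 ht
    by_cases ha : t ∈ V a
    · simp [ha, hVm ha]
    · by_cases hb : t ∈ V b <;> simp [ha, hb]) (by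
    intro t
    by_cases ht : (m : ℕ∞) < g t
    · have hp : 0 < Metric.infDist (t : ℝ) (SL g m)ᶜ := by
        rw [← hO.isClosed_compl.notMem_iff_infDist_pos hne]
        simpa [SL_val] using ht
      obtain ⟨j, hj⟩ := exists_nat_one_div_lt hp
      refine le_trans ?_ (le_iSup _ j)
      have : t ∈ V j := hj
      simp [this]
    · refine le_trans ?_ (le_iSup _ 0)
      split_ifs
      · exact le_rfl
      · exact le_min le_rfl (not_lt.1 ht))
  refine ⟨1 / ((j : ℝ) + 1), by positivity, ?_⟩
  rintro s ⟨hs, hfs⟩ y hy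
  have h1 := lt_of_lt_of_le hfs (hj ⟨s, hs⟩)
  have hsV : (⟨s, hs⟩ : Io01) ∈ V j := by
    by_contra hc
    simp [hc] at h1
  by_contra hyn
  have h2 : 1 / ((j : ℝ) + 1) < Metric.infDist s (SL g m)ᶜ := hsV
  have h3 := Metric.infDist_le_dist_of_mem (x := s) (s := (SL g m)ᶜ) hyn
  rw [dist_comm, Real.dist_eq] at h3
  linarith

theorem wb_of_eps {f g : Io01 → ℕ∞} (hb : ∃ N : ℕ, ∀ t, f t ≤ N)
    (he : ∀ m, ∃ ε > 0, ∀ s ∈ SL f m, ∀ y : ℝ, |y - s| < ε → y ∈ SL g m) :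
    WayBelowLsc f g := by
  intro h hl hm hs
  obtain ⟨N, hN⟩ := hb
  have key : ∀ m : ℕ, ∃ j, ∀ t, (m : ℕ∞) < f t → (m : ℕ∞) < h j t := by
    intro m
    obtain ⟨ε, hε, H⟩ := he m
    have hK : closure (SL f m) ⊆ SL g m := by
      intro y hy
      obtain ⟨s, hs, hd⟩ := Metric.mem_closure_iff.1 hy ε hε
      exact H s hs y hd
    have hbd : Bornology.IsBounded (SL f m) :=
      (Metric.isBounded_Ioo (0:ℝ) 1).subset (fun y hy => hy.1)
    have hc : IsCompact ((Subtype.val : Io01 → ℝ) ⁻¹' closure (SL f m)) := by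
      apply Topology.IsInducing.subtypeVal.isCompact_preimage' hbd.isCompact_closure
      intro y hy
      exact ⟨⟨y, (hK hy).1⟩, rfl⟩
    obtain ⟨j, hj⟩ := hc.elim_directed_cover (fun j => {t | (m : ℕ∞) < h j t})
      (fun j => hl j m) (by
        intro t ht
        have h1 : (m : ℕ∞) < g t := (SL_val g m t).1 (hK ht)
        have h2 := lt_of_lt_of_le h1 (hs t)
        obtain ⟨j, hj⟩ := lt_iSup_iff.1 h2
        exact mem_iUnion.2 ⟨j, hj⟩) (by
        apply Monotone.directed_le
        intro a b hab t ht
        exact lt_of_lt_of_le ht (hm hab t))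
    exact ⟨j, fun t ht => hj (subset_closure ((SL_val f m t).2 ht))⟩
  choose j hj using key
  refine ⟨(Finset.range N).sup j, fun t => ?_⟩
  by_contra hc
  rw [not_le] at hc
  obtain ⟨p, hp⟩ := ENat.ne_top_iff_exists.1 (ne_top_of_lt hc)
  have hpN : p < N := by
    have := lt_of_lt_of_le hc (hN t)
    rw [← hp] at this
    exact ENat.natCast_lt_natCast.1 this
  have h1 := hj p t (by rw [hp]; exact hc)
  have h2 := hm (Finset.le_sup (f := j) (Finset.mem_range.2 hpN)) t
  rw [hp] at h1
  exact absurd (lt_of_lt_of_le h1 h2) (lt_irrefl _)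

def Cellular (D : ℝ) (A : Set ℝ) : Prop :=
  ∀ i : ℤ, ∀ s ∈ A, ∀ t : ℝ, (i - 1) * D < s → s < i * D → (i - 1) * D < t → t < i * D → t ∈ A

theorem cellular_SL {n : ℕ} {f : Io01 → ℕ∞} (hf : f ∈ Mdyadic n) (m : ℕ) :
    Cellular (1 / 2 ^ n) (SL f m) := by
  rintro i s ⟨hs, hfs⟩ t h1 h2 h3 h4
  have hP : (0:ℝ) < 2 ^ n := by positivity
  have hD : (0:ℝ) < 1 / 2 ^ n := by positivity
  have hi : 0 < i := by
    have : (0:ℝ) < i := by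
      by_contra hc
      nlinarith [hs.1]
    exact_mod_cast this
  lift i to ℕ using hi.le
  simp only [Int.cast_natCast] at *
  have hi1 : 1 ≤ i := by omega
  have hi2 : i ≤ 2 ^ n := by
    have : (i : ℝ) - 1 < 2 ^ n := by
      have := h1.trans hs.2
      rw [mul_one_div, div_lt_one hP] at this
      exact this
    have : (i : ℝ) < ((2 ^ n + 1 : ℕ) : ℝ) := by push_cast; linarith
    have := Nat.cast_lt.1 this
    omega
  have hi1' : (1:ℝ) ≤ i := by exact_mod_cast hi1
  have hi2' : (i:ℝ) ≤ 2 ^ n := by exact_mod_cast hi2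
  rw [mul_one_div] at h1 h2 h3 h4
  have ht : t ∈ Set.Ioo (0:ℝ) 1 :=
    ⟨lt_of_le_of_lt (div_nonneg (by linarith) hP.le) h3,
      lt_of_lt_of_le h4 ((div_le_one hP).2 hi2')⟩
  refine ⟨ht, ?_⟩
  rw [← hf.2.2 i hi1 hi2 ⟨s, hs⟩ ⟨t, ht⟩ ⟨h1, h2⟩ ⟨h3, h4⟩]
  exact hfs

theorem cell_neg {D : ℝ} {A : Set ℝ} (h : Cellular D A) : Cellular D (-A) := by
  intro i s hs t h1 h2 h3 h4
  exact h (1 - i) (-s) hs (-t) (by push_cast; linarith) (by push_cast; linarith)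
    (by push_cast; linarith) (by push_cast; linarith)

theorem cell_right {D ε : ℝ} (hD : 0 < D) (hε : 0 < ε) {A B : Set ℝ} (hA : Cellular D A)
    (hB : Cellular D B) (H : ∀ s ∈ A, ∀ y : ℝ, |y - s| < ε → y ∈ B)
    {u t : ℝ} (hu : u ∈ A) (hut : u ≤ t) (htD : t < u + D) : t ∈ B := by
  have hAB : ∀ s ∈ A, s ∈ B := fun s hs => H s hs s (by simpa using hε)
  have e1 : u ≤ ⌈u / D⌉ * D := (div_le_iff₀ hD).1 (Int.le_ceil _)
  have e2 : (⌈u / D⌉ - 1) * D < u := by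
    have := Int.ceil_lt_add_one (u / D)
    rw [← lt_div_iff₀ hD]; linarith
  generalize ⌈u / D⌉ = c at e1 e2
  by_cases htx : t < c * D
  · exact hB c u (hAB u hu) t e2 (by linarith) (by linarith) htx
  rw [not_lt] at htx
  -- the grid point has a neighbourhood in B
  obtain ⟨v, hv, hv1, hv2⟩ : ∃ v ∈ A, v ≤ c * D ∧ c * D - ε / 2 < v := by
    rcases e1.eq_or_lt with e | e
    · exact ⟨u, hu, e1, by linarith⟩
    · refine ⟨max u (c * D - ε / 4), hA c u hu _ e2 e (lt_max_of_lt_left e2)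
        (max_lt e (by linarith)), max_le e1 (by linarith), lt_max_of_lt_right (by linarith)⟩
  rcases htx.eq_or_lt with e | e
  · exact H v hv t (by rw [abs_lt]; constructor <;> linarith)
  · have hw : min t (c * D + ε / 4) ∈ B := by
      have a1 : c * D < min t (c * D + ε / 4) := lt_min e (by linarith)
      have a2 := min_le_right t (c * D + ε / 4)
      exact H v hv _ (by rw [abs_lt]; constructor <;> linarith)
    have a1 : c * D < min t (c * D + ε / 4) := lt_min e (by linarith)
    have a3 := min_le_left t (c * D + ε / 4)
    exact hB (c + 1) _ hw t (by push_cast; linarith) (by push_cast; linarith)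
      (by push_cast; linarith) (by push_cast; linarith)

theorem cell_both {D ε : ℝ} (hD : 0 < D) (hε : 0 < ε) {A B : Set ℝ} (hA : Cellular D A)
    (hB : Cellular D B) (H : ∀ s ∈ A, ∀ y : ℝ, |y - s| < ε → y ∈ B)
    {u t : ℝ} (hu : u ∈ A) (htD : |t - u| < D) : t ∈ B := by
  rw [abs_lt] at htD
  rcases le_total u t with h | h
  · exact cell_right hD hε hA hB H hu h (by linarith)
  · have := cell_right hD hε (cell_neg hA) (cell_neg hB) (u := -u) (t := -t) (by
      intro s hs y hy
      refine H (-s) hs (-y) ?_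
      rw [← abs_neg]
      convert hy using 2
      ring) (by simpa using hu) (by linarith) (by linarith)
    simpa using this

noncomputable def hfun (δ : ℝ) (f : Io01 → ℕ∞) (t : Io01) : ℕ∞ :=
  ⨆ s : Io01, ⨆ _ : |(s : ℝ) - t| < δ, f s

theorem lt_hfun {δ : ℝ} {f : Io01 → ℕ∞} {t : Io01} {m : ℕ∞} :
    m < hfun δ f t ↔ ∃ s : Io01, |(s : ℝ) - t| < δ ∧ m < f s := by
  simp [hfun, lt_iSup_iff]

theorem hfun_lsc (δ : ℝ) (f : Io01 → ℕ∞) : IsLscFn (hfun δ f) := by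
  intro m
  have : {t | (m : ℕ∞) < hfun δ f t}
      = ⋃ s : Io01, ⋃ _ : (m : ℕ∞) < f s, {t : Io01 | |(s : ℝ) - t| < δ} := by
    ext t
    simp [lt_hfun, and_comm]
  rw [this]
  exact isOpen_iUnion fun s => isOpen_iUnion fun _ =>
    isOpen_lt (by fun_prop) continuous_const

theorem hfun_le {δ : ℝ} {f : Io01 → ℕ∞} (hf : ∀ m, Cellular (2 * δ) (SL f m)) (hft : ∀ t, f t ≠ ⊤)
    (c : ℤ) (s t : Io01) (hs : |(s : ℝ) - c * (2 * δ)| < δ) (ht : |(t : ℝ) - c * (2 * δ)| < δ) :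
    hfun δ f s ≤ hfun δ f t := by
  refine le_of_forall_lt fun a ha => ?_
  obtain ⟨m, rfl⟩ := ENat.ne_top_iff_exists.1 (ne_top_of_lt ha)
  obtain ⟨u, hu, hm⟩ := lt_hfun.1 ha
  rw [lt_hfun]
  have hu' := (SL_val f m u).2 hm
  suffices h : ∃ v ∈ SL f m, |v - t| < δ by
    obtain ⟨v, ⟨hv, hv1⟩, hv2⟩ := h
    exact ⟨⟨v, hv⟩, hv2, hv1⟩
  rw [abs_lt] at hs ht hu
  generalize hx : (c : ℝ) * (2 * δ) = x at hs ht
  rcases lt_trichotomy (u : ℝ) x with h | h | h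
  · have a1 : max (u : ℝ) ((t - δ + x) / 2) < x := max_lt h (by linarith)
    have a2 := le_max_left (u : ℝ) ((t - δ + x) / 2)
    have a3 := le_max_right (u : ℝ) ((t - δ + x) / 2)
    exact ⟨max (u : ℝ) ((t - δ + x) / 2), hf m c u hu' _ (by linarith) (by linarith)
      (by linarith) (by linarith), by rw [abs_lt]; constructor <;> linarith⟩
  · exact ⟨u, hu', by rw [abs_lt]; constructor <;> linarith⟩
  · have a1 : x < min (u : ℝ) ((t + δ + x) / 2) := lt_min h (by linarith)
    have a2 := min_le_left (u : ℝ) ((t + δ + x) / 2)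
    have a3 := min_le_right (u : ℝ) ((t + δ + x) / 2)
    exact ⟨min (u : ℝ) ((t + δ + x) / 2), hf m (c + 1) u hu' _ (by push_cast; linarith)
      (by push_cast; linarith) (by push_cast; linarith) (by push_cast; linarith),
      by rw [abs_lt]; constructor <;> linarith⟩

/-- Interpolation in the dyadic monoids: between `g' ≪ g` in `M_n` one finds `h ∈ M_{n+1}`. -/
theorem Mdyadic_interpolation (n : ℕ) (hn : 1 ≤ n)
    (g' g : Io01 → ℕ∞) (hg' : g' ∈ Mdyadic n) (hg : g ∈ Mdyadic n)
    (hwb : WayBelowLsc g' g) :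
    ∃ h ∈ Mdyadic (n + 1), WayBelowLsc g' h ∧ WayBelowLsc h g := by
  obtain ⟨N, hN⟩ := wb_bdd hg.1 hwb
  have heps := wb_eps hg.1 hwb
  obtain ⟨δ, hδ⟩ : ∃ δ : ℝ, δ = 1 / 2 ^ (n + 1) := ⟨_, rfl⟩
  have hδ0 : 0 < δ := by rw [hδ]; positivity
  have hD : (1:ℝ) / 2 ^ n = 2 * δ := by rw [hδ, pow_succ]; field_simp
  have hA := fun m => cellular_SL hg' m
  have hB := fun m => cellular_SL hg m
  rw [hD] at hA hB
  have hbd : ∀ t, hfun δ g' t ≤ N := fun t => iSup_le fun s => iSup_le fun _ => hN s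
  refine ⟨hfun δ g', ⟨hfun_lsc _ _, fun t => ne_top_of_le_ne_top (ENat.natCast_ne_top N) (hbd t), ?_⟩,
    wb_of_eps ⟨N, hN⟩ ?_, wb_of_eps ⟨N, hbd⟩ ?_⟩
  · intro k _ _ s t hs ht
    have e : ∀ a : ℝ, a / 2 ^ (n + 1) = a * δ := fun a => by rw [hδ]; ring
    simp only [e, Set.mem_Ioo] at hs ht
    obtain ⟨c, hc⟩ : ∃ c : ℤ, ∀ y : ℝ, ((k : ℝ) - 1) * δ < y ∧ y < k * δ →
        |y - c * (2 * δ)| < δ := by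
      rcases Nat.even_or_odd' k with ⟨i, rfl | rfl⟩
      · refine ⟨i, fun y hy => ?_⟩
        push_cast at hy ⊢
        rw [abs_lt]; constructor <;> linarith
      · refine ⟨i, fun y hy => ?_⟩
        push_cast at hy ⊢
        rw [abs_lt]; constructor <;> linarith
    exact le_antisymm (hfun_le hA hg'.2.1 c s t (hc _ hs) (hc _ ht))
      (hfun_le hA hg'.2.1 c t s (hc _ ht) (hc _ hs))
  · intro m
    obtain ⟨ε, hε, H⟩ := heps m
    refine ⟨min ε δ, lt_min hε hδ0, fun s hs y hy => ?_⟩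
    obtain ⟨hy1, -⟩ := H s hs y (hy.trans_le (min_le_left _ _))
    refine ⟨hy1, lt_hfun.2 ⟨⟨s, hs.1⟩, ?_, hs.2⟩⟩
    rw [abs_sub_comm]
    exact hy.trans_le (min_le_right _ _)
  · intro m
    obtain ⟨ε, hε, H⟩ := heps m
    refine ⟨δ, hδ0, ?_⟩
    rintro s ⟨hs, hs1⟩ y hy
    obtain ⟨u, hu, hmu⟩ := lt_hfun.1 hs1
    refine cell_both (by linarith) hε (hA m) (hB m) H ((SL_val g' m u).2 hmu) ?_
    simp only [abs_lt] at *
    constructor <;> linarith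
end

section
/- Let f : ]0,1[ → ℕ be a finite-valued lower semicontinuous function and let n ∈ ℕ, n ≥ 1. Then the set {g ∈ M_n | g ≪ f} has a largest element, denoted ε_n(f). Moreover, the sequence (ε_n(f))_{n≥1} is increasing in the pointwise order and its pointwise supremum is f. -/
open Set

theorem aux_isLsc_max {f g : Io01 → ℕ∞} (hf : IsLscFn f) (hg : IsLscFn g) : IsLscFn (f ⊔ g) := by
  intro m
  have : {t | (m : ℕ∞) < (f ⊔ g) t} = {t | (m : ℕ∞) < f t} ∪ {t | (m : ℕ∞) < g t} := by
    ext t; simp [lt_sup_iff]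
  rw [this]
  exact (hf m).union (hg m)

theorem aux_wb_le {f g : Io01 → ℕ∞} (hf : IsLscFn f) (h : WayBelowLsc g f) : g ≤ f := by
  obtain ⟨m, hm⟩ := h (fun _ => f) (fun _ => hf) (fun _ _ _ => le_rfl) (fun t => by simp)
  exact hm

theorem aux_wb_max {f g k : Io01 → ℕ∞} (hf : WayBelowLsc f k) (hg : WayBelowLsc g k) :
    WayBelowLsc (f ⊔ g) k := by
  intro h h1 h2 h3
  obtain ⟨a, ha⟩ := hf h h1 h2 h3
  obtain ⟨b, hb⟩ := hg h h1 h2 h3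
  exact ⟨max a b, sup_le (ha.trans (h2 (le_max_left _ _))) (hb.trans (h2 (le_max_right _ _)))⟩

theorem aux_M_max {n : ℕ} {f g : Io01 → ℕ∞} (hf : f ∈ Mdyadic n) (hg : g ∈ Mdyadic n) :
    f ⊔ g ∈ Mdyadic n := by
  refine ⟨aux_isLsc_max hf.1 hg.1, ?_, ?_⟩
  · intro t
    rcases le_total (f t) (g t) with h | h
    · simpa [Pi.sup_apply, sup_eq_right.2 h] using hg.2.1 t
    · simpa [Pi.sup_apply, sup_eq_left.2 h] using hf.2.1 t
  · intro k h1 h2 s t hs ht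
    simp only [Pi.sup_apply]
    rw [hf.2.2 k h1 h2 s t hs ht, hg.2.2 k h1 h2 s t hs ht]

theorem aux_M_mono (n : ℕ) : Mdyadic n ⊆ Mdyadic (n + 1) := by
  intro g hg
  refine ⟨hg.1, hg.2.1, ?_⟩
  intro k h1 h2 s t hs ht
  have hp : (0 : ℝ) < 2 ^ n := by positivity
  have key : ∀ s : ℝ, s ∈ Set.Ioo (((k : ℝ) - 1) / 2 ^ (n+1)) ((k : ℝ) / 2 ^ (n+1)) →
      s ∈ Set.Ioo (((((k + 1) / 2 : ℕ) : ℝ) - 1) / 2 ^ n) ((((k + 1) / 2 : ℕ) : ℝ) / 2 ^ n) := by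
    intro s hs
    have a1 : 2 * ((k + 1) / 2) ≤ k + 1 := by omega
    have a2 : k ≤ 2 * ((k + 1) / 2) := by omega
    have b1 : 2 * (((k + 1) / 2 : ℕ) : ℝ) ≤ k + 1 := by exact_mod_cast a1
    have b2 : (k : ℝ) ≤ 2 * (((k + 1) / 2 : ℕ) : ℝ) := by exact_mod_cast a2
    obtain ⟨c1, c2⟩ := hs
    rw [div_lt_iff₀ (by positivity), pow_succ] at c1
    rw [lt_div_iff₀ (by positivity), pow_succ] at c2
    constructor
    · rw [div_lt_iff₀ hp]; linarith
    · rw [lt_div_iff₀ hp]; linarith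
  refine hg.2.2 ((k + 1) / 2) (by omega) ?_ s t (key _ hs) (key _ ht)
  rw [pow_succ] at h2
  omega

/-- sample points -/
noncomputable def auxPt (n : ℕ) (i : Fin (2 ^ (n + 1) - 1)) : Io01 :=
  ⟨((i : ℕ) + 1 : ℝ) / 2 ^ (n + 1), by
    have h : (i : ℕ) + 1 < 2 ^ (n + 1) := by have := i.2; omega
    have h' : ((i : ℕ) + 1 : ℝ) < 2 ^ (n + 1) := by exact_mod_cast h
    constructor
    · positivity
    · rw [div_lt_one (by positivity)]; exact h'⟩

theorem aux_pt (n j : ℕ) (h0 : 1 ≤ j) (h1 : j < 2 ^ (n + 1)) :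
    ∃ i, (auxPt n i : ℝ) = (j : ℝ) / 2 ^ (n + 1) := by
  refine ⟨⟨j - 1, by omega⟩, ?_⟩
  simp only [auxPt]
  rw [Nat.cast_sub h0]; simp

theorem aux_inj (n : ℕ) {f g : Io01 → ℕ∞} (hf : f ∈ Mdyadic n) (hg : g ∈ Mdyadic n)
    (h : ∀ i, f (auxPt n i) = g (auxPt n i)) : f = g := by
  funext t
  have hp : (0 : ℝ) < 2 ^ n := by positivity
  obtain ⟨t0, t1⟩ := t.2
  set q := ⌊(t : ℝ) * 2 ^ n⌋₊ with hq
  have q1 : (q : ℝ) ≤ t * 2 ^ n := Nat.floor_le (by positivity)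
  have q2 : (t : ℝ) * 2 ^ n < q + 1 := Nat.lt_floor_add_one _
  have q3 : q < 2 ^ n := by
    have : (q : ℝ) < 2 ^ n := by nlinarith
    exact_mod_cast this
  rcases q1.eq_or_lt with he | hl
  · have q0 : 1 ≤ q := by
      by_contra hc
      have : q = 0 := by omega
      rw [this] at he
      have : 0 < (t : ℝ) * 2 ^ n := by positivity
      simp at he; linarith
    obtain ⟨i, hi⟩ := aux_pt n (2 * q) (by omega) (by rw [pow_succ]; omega)
    have : t = auxPt n i := by
      apply Subtype.ext
      rw [hi, pow_succ]; push_cast; rw [he]; field_simp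
    rw [this]; exact h i
  · obtain ⟨i, hi⟩ := aux_pt n (2 * q + 1) (by omega) (by rw [pow_succ]; omega)
    have m1 : (t : ℝ) ∈ Set.Ioo ((((q + 1 : ℕ) : ℝ) - 1) / 2 ^ n) (((q + 1 : ℕ) : ℝ) / 2 ^ n) := by
      constructor
      · rw [div_lt_iff₀ hp]; push_cast; linarith
      · rw [lt_div_iff₀ hp]; push_cast; linarith
    have m2 : (auxPt n i : ℝ) ∈
        Set.Ioo ((((q + 1 : ℕ) : ℝ) - 1) / 2 ^ n) (((q + 1 : ℕ) : ℝ) / 2 ^ n) := by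
      have e : (((2 * q + 1 : ℕ) : ℝ)) / 2 ^ (n + 1) = ((q : ℝ) + 1 / 2) / 2 ^ n := by
        rw [pow_succ]; push_cast; field_simp
      rw [hi, e]
      constructor
      · apply div_lt_div_of_pos_right _ hp; push_cast; linarith
      · apply div_lt_div_of_pos_right _ hp; push_cast; linarith
    rw [hf.2.2 (q + 1) (by omega) (by omega) t _ m1 m2,
      hg.2.2 (q + 1) (by omega) (by omega) t _ m1 m2, h i]

theorem aux_finite (f : Io01 → ℕ∞) (hf : IsLscFn f) (hfin : ∀ t, f t ≠ ⊤) (n : ℕ) :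
    {g | g ∈ Mdyadic n ∧ WayBelowLsc g f}.Finite := by
  have hF : (Set.univ.pi fun i : Fin (2 ^ (n + 1) - 1) => Set.Iic (f (auxPt n i))).Finite := by
    apply Set.Finite.pi
    intro i
    obtain ⟨N, hN⟩ := ENat.ne_top_iff_exists.1 (hfin (auxPt n i))
    rw [← hN]
    refine ((Set.finite_Iic N).image (fun k : ℕ => (k : ℕ∞))).subset ?_
    intro x hx
    obtain ⟨k, rfl⟩ := ENat.ne_top_iff_exists.1 (ne_top_of_le_ne_top (ENat.coe_ne_top N) hx)
    exact ⟨k, by simpa using hx, rfl⟩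
  refine Set.Finite.of_injOn (f := fun g i => g (auxPt n i)) ?_ ?_ hF
  · intro g hg i _
    exact aux_wb_le hf hg.2 _
  · intro g hg k hk h
    exact aux_inj n hg.1 hk.1 (fun i => congrFun h i)

theorem aux_zero (f : Io01 → ℕ∞) (n : ℕ) : (0 : Io01 → ℕ∞) ∈ {g | g ∈ Mdyadic n ∧ WayBelowLsc g f} := by
  refine ⟨⟨fun m => by simp, by simp, by simp⟩, fun h _ _ _ => ⟨0, fun t => by simp⟩⟩

theorem aux_greatest (f : Io01 → ℕ∞) (hf : IsLscFn f) (hfin : ∀ t, f t ≠ ⊤) (n : ℕ) :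
    ∃ e, IsGreatest {g | g ∈ Mdyadic n ∧ WayBelowLsc g f} e := by
  obtain ⟨e, he⟩ := (aux_finite f hf hfin n).exists_maximal ⟨0, aux_zero f n⟩
  refine ⟨e, he.1, fun g hg => ?_⟩
  have : e ⊔ g ≤ e := he.2 ⟨aux_M_max he.1.1 hg.1, aux_wb_max he.1.2 hg.2⟩ le_sup_left
  exact le_sup_right.trans this

theorem aux_bump (f : Io01 → ℕ∞) (n : ℕ) (i j : ℤ) (N : ℕ)
    (hsub : ∀ x : ℝ, x ∈ Set.Icc ((i : ℝ) / 2 ^ n) ((j : ℝ) / 2 ^ n) →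
      ∃ s : Io01, (s : ℝ) = x ∧ ((N + 1 : ℕ) : ℕ∞) ≤ f s) :
    ∃ g ∈ {g | g ∈ Mdyadic n ∧ WayBelowLsc g f},
      ∀ t : Io01, (t : ℝ) ∈ Set.Ioo ((i : ℝ) / 2 ^ n) ((j : ℝ) / 2 ^ n) →
        g t = ((N + 1 : ℕ) : ℕ∞) := by
  classical
  have hp : (0 : ℝ) < 2 ^ n := by positivity
  let S : Set Io01 := Subtype.val ⁻¹' Set.Ioo ((i : ℝ) / 2 ^ n) ((j : ℝ) / 2 ^ n)
  have hS : IsOpen S := isOpen_Ioo.preimage continuous_subtype_val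
  let K : Set Io01 := Subtype.val ⁻¹' Set.Icc ((i : ℝ) / 2 ^ n) ((j : ℝ) / 2 ^ n)
  have hK : IsCompact K := by
    rw [Subtype.isCompact_iff]
    have : (Subtype.val '' K : Set ℝ) = Set.Icc ((i : ℝ) / 2 ^ n) ((j : ℝ) / 2 ^ n) := by
      ext x
      constructor
      · rintro ⟨s, hs, rfl⟩; exact hs
      · intro hx
        obtain ⟨s, rfl, -⟩ := hsub x hx
        exact ⟨s, hx, rfl⟩
    rw [this]
    exact isCompact_Icc
  let g : Io01 → ℕ∞ := fun t => if t ∈ S then ((N + 1 : ℕ) : ℕ∞) else 0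
  have hgS : ∀ t, t ∈ S → g t = ((N + 1 : ℕ) : ℕ∞) := fun t ht => if_pos ht
  have hgS' : ∀ t, t ∉ S → g t = 0 := fun t ht => if_neg ht
  refine ⟨g, ⟨⟨?_, ?_, ?_⟩, ?_⟩, fun t ht => hgS t ht⟩
  · intro m
    by_cases hm : (m : ℕ∞) < ((N + 1 : ℕ) : ℕ∞)
    · convert hS using 1
      ext t
      by_cases ht : t ∈ S
      · simp only [Set.mem_setOf_eq, hgS t ht, hm, ht]
      · simp [hgS' t ht, ht]
    · convert isOpen_empty using 1
      ext t
      by_cases ht : t ∈ S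
      · simp only [Set.mem_setOf_eq, hgS t ht, hm, Set.mem_empty_iff_false]
      · simp [hgS' t ht]
  · intro t
    by_cases ht : t ∈ S
    · rw [hgS t ht]; exact ENat.coe_ne_top _
    · rw [hgS' t ht]; simp
  · intro k h1 h2 s t hs ht
    have key : ∀ s t : Io01, (s : ℝ) ∈ Set.Ioo (((k : ℝ) - 1) / 2 ^ n) ((k : ℝ) / 2 ^ n) →
      (t : ℝ) ∈ Set.Ioo (((k : ℝ) - 1) / 2 ^ n) ((k : ℝ) / 2 ^ n) → s ∈ S → t ∈ S := by
      intro s t hs ht h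
      have c1 : (i : ℝ) < k := (div_lt_div_iff_of_pos_right hp).1 (h.1.trans hs.2)
      have c2 : (k : ℝ) - 1 < j := (div_lt_div_iff_of_pos_right hp).1 (hs.1.trans h.2)
      have d1 : i < k := by exact_mod_cast c1
      have d2 : (k : ℤ) - 1 < j := by exact_mod_cast c2
      have e1 : i ≤ (k : ℤ) - 1 := by omega
      have e2 : (k : ℤ) ≤ j := by omega
      have f1 : (i : ℝ) ≤ (k : ℝ) - 1 := by exact_mod_cast e1
      have f2 : (k : ℝ) ≤ j := by exact_mod_cast e2
      exact ⟨((div_le_div_iff_of_pos_right hp).2 f1).trans_lt ht.1,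
        ht.2.trans_le ((div_le_div_iff_of_pos_right hp).2 f2)⟩
    by_cases h : s ∈ S
    · rw [hgS s h, hgS t (key s t hs ht h)]
    · rw [hgS' s h, hgS' t (fun h' => h (key t s ht hs h'))]
  · intro h h1 h2 h3
    obtain ⟨m, hm⟩ := hK.elim_directed_cover (fun m => {t | (N : ℕ∞) < h m t}) (fun m => h1 m N)
      (by
        intro s hs
        obtain ⟨s', hs', hle⟩ := hsub s hs
        obtain rfl := Subtype.ext hs'
        have : (N : ℕ∞) < ⨆ m, h m s' :=
          lt_of_lt_of_le (by exact_mod_cast Nat.lt_succ_self N) (hle.trans (h3 s'))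
        obtain ⟨m, hm⟩ := lt_iSup_iff.1 this
        exact Set.mem_iUnion.2 ⟨m, hm⟩)
      (by
        apply Monotone.directed_le
        intro a b hab t ht
        exact lt_of_lt_of_le ht (h2 hab t))
    refine ⟨m, fun t => ?_⟩
    by_cases ht : t ∈ S
    · rw [hgS t ht]
      have : (N : ℕ∞) < h m t := hm ⟨ht.1.le, ht.2.le⟩
      simpa using Order.add_one_le_of_lt this
    · rw [hgS' t ht]; simp

theorem aux_approx (f : Io01 → ℕ∞) (hf : IsLscFn f) (t : Io01) (N : ℕ)
    (hN : f t = ((N + 1 : ℕ) : ℕ∞)) :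
    ∃ n, ∃ g ∈ {g | g ∈ Mdyadic (n + 1) ∧ WayBelowLsc g f}, g t = f t := by
  have hU : IsOpen (Subtype.val '' {s : Io01 | (N : ℕ∞) < f s} : Set ℝ) :=
    isOpen_Ioo.isOpenMap_subtype_val _ (hf N)
  have htU : (t : ℝ) ∈ (Subtype.val '' {s : Io01 | (N : ℕ∞) < f s} : Set ℝ) :=
    ⟨t, by rw [Set.mem_setOf_eq, hN]; exact_mod_cast Nat.lt_succ_self N, rfl⟩
  obtain ⟨δ, hδ, hb⟩ := Metric.isOpen_iff.1 hU _ htU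
  obtain ⟨n, hn⟩ := exists_pow_lt_of_lt_one hδ (by norm_num : (1 / 2 : ℝ) < 1)
  have hp : (0 : ℝ) < 2 ^ (n + 1) := by positivity
  have hn' : 2 < δ * 2 ^ (n + 1) := by
    rw [one_div, inv_pow, inv_lt_iff_one_lt_mul₀ (by positivity)] at hn
    rw [pow_succ]; linarith
  set q := ⌊(t : ℝ) * 2 ^ (n + 1)⌋ with hq
  have q1 : (q : ℝ) ≤ t * 2 ^ (n + 1) := Int.floor_le _
  have q2 : (t : ℝ) * 2 ^ (n + 1) < q + 1 := Int.lt_floor_add_one _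
  obtain ⟨g, hg, hgt⟩ := aux_bump f (n + 1) (q - 1) (q + 1) N (by
    intro x hx
    obtain ⟨x1, x2⟩ := hx
    rw [div_le_iff₀ hp] at x1
    rw [le_div_iff₀ hp] at x2
    push_cast at x1 x2
    have : x ∈ Metric.ball (t : ℝ) δ := by
      rw [Metric.mem_ball, Real.dist_eq, abs_lt]
      constructor
      · by_contra hc
        have := mul_le_mul_of_nonneg_right (not_lt.1 hc) hp.le
        linarith
      · by_contra hc
        have := mul_le_mul_of_nonneg_right (not_lt.1 hc) hp.le
        linarith
    obtain ⟨s, hs, rfl⟩ := hb this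
    exact ⟨s, rfl, by simpa using Order.add_one_le_of_lt hs⟩)
  refine ⟨n, g, hg, ?_⟩
  rw [hN]
  apply hgt
  constructor
  · rw [div_lt_iff₀ hp]; push_cast; linarith
  · rw [lt_div_iff₀ hp]; push_cast; linarith

/-- For a finite-valued lsc function `f`, the set `{g ∈ M_n | g ≪ f}` has a largest element
`ε_n(f)`; these form an increasing sequence with pointwise supremum `f`. -/
theorem Mdyadic_greatest_approx
    (f : Io01 → ℕ∞) (hf : IsLscFn f) (hfin : ∀ t, f t ≠ ⊤) :
    ∃ e : ℕ → (Io01 → ℕ∞),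
      (∀ n : ℕ, 1 ≤ n → IsGreatest {g | g ∈ Mdyadic n ∧ WayBelowLsc g f} (e n)) ∧
      (∀ n : ℕ, 1 ≤ n → e n ≤ e (n + 1)) ∧
      (∀ t : Io01, f t = ⨆ n : ℕ, e (n + 1) t) := by
  choose e he using aux_greatest f hf hfin
  refine ⟨e, fun n _ => he n, fun n _ => ?_, fun t => le_antisymm ?_ ?_⟩
  · exact (he (n + 1)).2 ⟨aux_M_mono n (he n).1.1, (he n).1.2⟩
  · obtain ⟨N, hN⟩ := ENat.ne_top_iff_exists.1 (hfin t)
    rcases N with _ | N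
    · rw [← hN]; simp
    · obtain ⟨n, g, hg, hgt⟩ := aux_approx f hf t N hN.symm
      rw [← hgt]
      exact le_iSup_of_le n ((he (n + 1)).2 hg t)
  · exact iSup_le fun n => aux_wb_le hf (he (n + 1)).1.2 t
end
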